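/- Let n, p, q be integers with p ≥ 1, q ≥ 1 and n ≥ p + q + 4, and let T = T(p, n−p−q−3, q) be the caterpillar of order n. Then the characteristic polynomial of the Randić matrix of T equals X^{n−6} · (X² − 1) · (X⁴ − (ζ(n,p,q)/η(n,p,q))X² + χ(n,p,q)/η(n,p,q)). -/

import Mathlib

open Polynomial

open scoped Classical in
/-- The Randić matrix of a simple graph `G`: the `(u,v)` entry is `1/√(d_u d_v)` when `uv` is
an edge and `0` otherwise, where `d_v` is the degree of the vertex `v`. -/
noncomputable def randicMatrix {V : Type*} (G : SimpleGraph V) : Matrix V V ℝ :=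
  Matrix.of fun u v =>
    if G.Adj u v then
      1 / Real.sqrt (((G.neighborSet u).ncard : ℝ) * ((G.neighborSet v).ncard : ℝ))
    else 0

lemma randicMatrix_isHermitian {V : Type*} (G : SimpleGraph V) :
    (randicMatrix G).IsHermitian := by
  ext u v
  by_cases h : G.Adj u v
  · simp [randicMatrix, Matrix.conjTranspose_apply, h, h.symm, mul_comm]
  · have h' : ¬ G.Adj v u := fun hc => h hc.symm
    simp [randicMatrix, Matrix.conjTranspose_apply, h, h']

/-- The Randić energy of a graph: the sum of the absolute values of the eigenvalues of its
Randić matrix. -/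
noncomputable def randicEnergy {V : Type*} [Fintype V] [DecidableEq V] (G : SimpleGraph V) : ℝ :=
  ∑ i, |(randicMatrix_isHermitian G).eigenvalues i|

/-- The caterpillar `T(p 0, …, p (r-1))`: a path `v_0 v_1 ⋯ v_{r-1}` (the `Sum.inl` vertices)
together with, for each `i`, `p i` pendant vertices attached to `v_i` (the `Sum.inr` vertices). -/
def caterpillar (r : ℕ) (p : Fin r → ℕ) :
    SimpleGraph ((Fin r) ⊕ (Σ i : Fin r, Fin (p i))) :=
  SimpleGraph.fromRel (fun u v =>
    (∃ i j : Fin r, u = Sum.inl i ∧ v = Sum.inl j ∧ (i : ℕ) + 1 = (j : ℕ)) ∨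
    (∃ (i : Fin r) (k : Fin (p i)), u = Sum.inl i ∧ v = Sum.inr ⟨i, k⟩))

namespace Matrix

lemma pow_card_mul_charpoly_fromBlocks_zero {R ι κ : Type*} [CommRing R] [Fintype ι] [Fintype κ]
    [DecidableEq ι] [DecidableEq κ] (A : Matrix ι ι R) (B : Matrix ι κ R) (B' : Matrix κ ι R) :
    X ^ Fintype.card ι * (fromBlocks A B B' 0).charpoly =
      X ^ Fintype.card κ *
        ((X : R[X]) • A.charmatrix - (B * B').map (C : R →+* R[X])).det := by
  have key : (fromBlocks A B B' 0).charmatrix *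
      fromBlocks ((X : R[X]) • (1 : Matrix ι ι R[X])) 0 (B'.map (C : R →+* R[X])) 1 =
      fromBlocks ((X : R[X]) • A.charmatrix - (B * B').map (C : R →+* R[X]))
        (-B.map (C : R →+* R[X])) 0 ((X : R[X]) • (1 : Matrix κ κ R[X])) := by
    rw [charmatrix_fromBlocks, fromBlocks_multiply, Matrix.map_mul]
    congr 1
    · simp [sub_eq_add_neg]
    · simp
    · simp [charmatrix_zero, ← Matrix.smul_one_eq_diagonal]
    · simp [charmatrix_zero, ← Matrix.smul_one_eq_diagonal]
  have hdet := congrArg det key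
  rw [det_mul, det_fromBlocks_zero₁₂, det_fromBlocks_zero₂₁, det_smul, det_smul, det_one,
    det_one, mul_one, mul_one, mul_one] at hdet
  rw [charpoly, mul_comm, hdet, mul_comm]

end Matrix

section Caterpillar

variable {r : ℕ} {p : Fin r → ℕ}

lemma caterpillar_adj_inl_inl {i j : Fin r} :
    (caterpillar r p).Adj (Sum.inl i) (Sum.inl j) ↔
      (i : ℕ) + 1 = (j : ℕ) ∨ (j : ℕ) + 1 = (i : ℕ) := by
  simp only [caterpillar, SimpleGraph.fromRel_adj]
  simp
  grind

lemma caterpillar_adj_inl_inr {i j : Fin r} {k : Fin (p j)} :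
    (caterpillar r p).Adj (Sum.inl i) (Sum.inr ⟨j, k⟩) ↔ i = j := by
  simp only [caterpillar, SimpleGraph.fromRel_adj]
  constructor
  · simp
    grind
  · rintro rfl
    exact ⟨Sum.inl_ne_inr, Or.inl (Or.inr ⟨i, k, rfl, rfl⟩)⟩

lemma not_caterpillar_adj_inr_inr {a b : Σ i : Fin r, Fin (p i)} :
    ¬ (caterpillar r p).Adj (Sum.inr a) (Sum.inr b) := by
  simp [caterpillar, SimpleGraph.fromRel_adj]

lemma ncard_neighborSet_caterpillar_inr (a : Σ i : Fin r, Fin (p i)) :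
    ((caterpillar r p).neighborSet (Sum.inr a)).ncard = 1 := by
  obtain ⟨j, k⟩ := a
  rw [Set.ncard_eq_one]
  refine ⟨Sum.inl j, ?_⟩
  ext v
  rcases v with i | b
  · simp [SimpleGraph.adj_comm, caterpillar_adj_inl_inr]
  · simp [not_caterpillar_adj_inr_inr]

lemma ncard_neighborSet_caterpillar_inl (i : Fin r) :
    ((caterpillar r p).neighborSet (Sum.inl i)).ncard =
      (Finset.univ.filter fun j : Fin r => (i : ℕ) + 1 = j ∨ (j : ℕ) + 1 = i).card + p i := by
  have h : (caterpillar r p).neighborSet (Sum.inl i) =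
      ((Finset.univ.filter fun j : Fin r => (i : ℕ) + 1 = j ∨ (j : ℕ) + 1 = i).disjSum
        (Finset.univ.map (Function.Embedding.sigmaMk (β := fun i => Fin (p i)) i)) :
        Finset (Fin r ⊕ Σ i : Fin r, Fin (p i))) := by
    ext v
    rcases v with j | ⟨j, k⟩
    · simp [caterpillar_adj_inl_inl]
    · simp only [SimpleGraph.mem_neighborSet, caterpillar_adj_inl_inr, Finset.mem_coe,
        Finset.inr_mem_disjSum, Finset.mem_map, Finset.mem_univ, true_and,
        Function.Embedding.sigmaMk_apply]
      constructor
      · rintro rfl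
        exact ⟨k, rfl⟩
      · rintro ⟨_, h⟩
        exact congrArg Sigma.fst h
  rw [h, Set.ncard_coe_finset, Finset.card_disjSum]
  simp

lemma toBlocks₁₂_mul_toBlocks₂₁_randicMatrix_caterpillar :
    (randicMatrix (caterpillar r p)).toBlocks₁₂ * (randicMatrix (caterpillar r p)).toBlocks₂₁ =
      Matrix.diagonal fun i =>
        (p i : ℝ) / ((caterpillar r p).neighborSet (Sum.inl i)).ncard := by
  ext i j
  rw [Matrix.mul_apply, Fintype.sum_sigma]
  simp only [Matrix.toBlocks₁₂, Matrix.toBlocks₂₁, randicMatrix, Matrix.of_apply,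
    caterpillar_adj_inl_inr, (caterpillar r p).adj_comm (Sum.inr _) (Sum.inl _),
    ncard_neighborSet_caterpillar_inr, Nat.cast_one, mul_one, one_mul, Finset.sum_const,
    Finset.card_univ, Fintype.card_fin, nsmul_eq_mul]
  rw [Finset.sum_eq_single i (fun b _ hb => by simp [hb.symm]) (by simp)]
  rcases eq_or_ne i j with rfl | hij
  · simp [← mul_inv, div_eq_mul_inv]
  · simp [hij, hij.symm]

lemma pow_mul_charpoly_randicMatrix_caterpillar :
    X ^ r * (randicMatrix (caterpillar r p)).charpoly =
      X ^ (∑ i, p i) * ((X : ℝ[X]) • (randicMatrix (caterpillar r p)).toBlocks₁₁.charmatrix -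
        Matrix.diagonal fun i =>
          C ((p i : ℝ) / ((caterpillar r p).neighborSet (Sum.inl i)).ncard)).det := by
  have h22 : (randicMatrix (caterpillar r p)).toBlocks₂₂ = 0 := by
    ext a b
    simp [Matrix.toBlocks₂₂, randicMatrix, not_caterpillar_adj_inr_inr]
  have h := Matrix.pow_card_mul_charpoly_fromBlocks_zero
    (randicMatrix (caterpillar r p)).toBlocks₁₁ (randicMatrix (caterpillar r p)).toBlocks₁₂
    (randicMatrix (caterpillar r p)).toBlocks₂₁
  rw [← h22, Matrix.fromBlocks_toBlocks, toBlocks₁₂_mul_toBlocks₂₁_randicMatrix_caterpillar,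
    Matrix.diagonal_map (map_zero _)] at h
  simpa using h

end Caterpillar

/-- For integers `p, q ≥ 1`, `n ≥ p + q + 4`, the characteristic polynomial of
the Randić matrix of the caterpillar `T(p, n-p-q-3, q)` of order `n` equals
`X^(n-6) (X² - 1)(X⁴ - (ζ/η) X² + χ/η)` where `η = (p+1)(q+1)(n-p-q-1)`,
`ζ = (n-p-q-2)(q(2p+1)+p)` and `χ = pq(n-p-q-3)`. -/
theorem caterpillar3_randic_charpoly (n p q : ℕ) (hp : 1 ≤ p) (hq : 1 ≤ q)
    (hn : p + q + 4 ≤ n) :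
    (randicMatrix (caterpillar 3 ![p, n - p - q - 3, q])).charpoly
      = X ^ (n - 6) * (X ^ 2 - 1) *
        (X ^ 4
          - C ((((n : ℝ) - p - q - 2) * ((q : ℝ) * (2 * (p : ℝ) + 1) + (p : ℝ))) /
              (((p : ℝ) + 1) * ((q : ℝ) + 1) * ((n : ℝ) - p - q - 1))) * X ^ 2
          + C (((p : ℝ) * (q : ℝ) * ((n : ℝ) - p - q - 3)) /
              (((p : ℝ) + 1) * ((q : ℝ) + 1) * ((n : ℝ) - p - q - 1)))) := by
  obtain ⟨m, rfl⟩ : ∃ m, n = m + 1 + p + q + 3 := ⟨n - p - q - 4, by omega⟩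
  have hm : m + 1 + p + q + 3 - p - q - 3 = m + 1 := by omega
  have hN : m + 1 + p + q = (m + 1 + p + q + 3 - 6) + 3 := by omega
  rw [hm]
  have h := pow_mul_charpoly_randicMatrix_caterpillar (r := 3) (p := ![p, m + 1, q])
  have hsum : ∑ i, ![p, m + 1, q] i = m + 1 + p + q := by
    simp [Fin.sum_univ_three]
    ring
  have d0 : ((caterpillar 3 ![p, m + 1, q]).neighborSet (Sum.inl 0)).ncard = 1 + p :=
    ncard_neighborSet_caterpillar_inl 0
  have d1 : ((caterpillar 3 ![p, m + 1, q]).neighborSet (Sum.inl 1)).ncard = 2 + (m + 1) :=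
    ncard_neighborSet_caterpillar_inl 1
  have d2 : ((caterpillar 3 ![p, m + 1, q]).neighborSet (Sum.inl 2)).ncard = 1 + q :=
    ncard_neighborSet_caterpillar_inl 2
  rw [hsum, hN, pow_add, mul_comm _ (X ^ 3), mul_assoc] at h
  rw [mul_left_cancel₀ (pow_ne_zero 3 X_ne_zero) h, mul_assoc]
  congr 1
  obtain ⟨s, hs⟩ : ∃ s : ℝ, s = (√(1 + p))⁻¹ * (√(2 + (m + 1)))⁻¹ := ⟨_, rfl⟩
  obtain ⟨t, ht⟩ : ∃ t : ℝ, t = (√(2 + (m + 1)))⁻¹ * (√(1 + q))⁻¹ := ⟨_, rfl⟩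
  have hs2 : s ^ 2 = (1 + p : ℝ)⁻¹ * (2 + (m + 1) : ℝ)⁻¹ := by
    rw [hs, mul_pow, inv_pow, inv_pow, Real.sq_sqrt (by positivity),
      Real.sq_sqrt (by positivity)]
  have ht2 : t ^ 2 = (2 + (m + 1) : ℝ)⁻¹ * (1 + q : ℝ)⁻¹ := by
    rw [ht, mul_pow, inv_pow, inv_pow, Real.sq_sqrt (by positivity),
      Real.sq_sqrt (by positivity)]
  have hA : (randicMatrix (caterpillar 3 ![p, m + 1, q])).toBlocks₁₁ =
      !![0, s, 0; s, 0, t; 0, t, 0] := by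
    rw [hs, ht]
    ext i j
    fin_cases i <;> fin_cases j <;>
      simp [Matrix.toBlocks₁₁, randicMatrix, caterpillar_adj_inl_inl, d0, d1, d2] <;>
      ring
  rw [hA, Matrix.det_fin_three]
  refine Polynomial.funext fun x => ?_
  simp [d0, d1, d2]
  have hden : ((p + 1) * (q + 1) * (m + 1 + p + q + 3 - p - q - 1) : ℝ) =
      (1 + p) * (1 + q) * (2 + (m + 1)) := by ring
  rw [hden, mul_assoc (_ - _) (t * x), mul_mul_mul_comm t, mul_mul_mul_comm s, ← sq t, ← sq s,
    hs2, ht2]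
  field_simp
  ring
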